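/- (Wielandt) Let K be a 𝒫-component of a finite group G and let N be a subnormal subgroup of G. Then either K ≤ N or [K,N] ≤ O_𝒫(K). -/

import Mathlib

open Pointwise

namespace PaperPF
set_option linter.unusedVariables false

/-- A subgroup `K` is subnormal if there is a finite chain
`K = K₀ ⊴ K₁ ⊴ ⋯ ⊴ Kₙ = G` with each term normal in the next. -/
def IsSubnormal {G : Type} [Group G] (K : Subgroup G) : Prop :=
  ∃ (n : ℕ) (c : Fin (n + 1) → Subgroup G),
    c 0 = K ∧ c (Fin.last n) = ⊤ ∧
      ∀ i : Fin n, c i.castSucc ≤ c i.succ ∧ ((c i.castSucc).subgroupOf (c i.succ)).Normal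

/-- A finite group is quasisimple if it is perfect and its central quotient is a
nonabelian simple group. -/
def IsQuasisimple (X : Type) [Group X] : Prop :=
  commutator X = ⊤ ∧ IsSimpleGroup (X ⧸ Subgroup.center X) ∧
    ∃ a b : X ⧸ Subgroup.center X, a * b ≠ b * a

/-- A component: a quasisimple subnormal subgroup. -/
def IsComponent {G : Type} [Group G] (K : Subgroup G) : Prop :=
  IsSubnormal K ∧ IsQuasisimple ↥K

/-- The subgroup generated by a family of subgroups. -/
def genBy {G : Type} [Group G] (S : Set (Subgroup G)) : Subgroup G :=
  Subgroup.closure (⋃ N ∈ S, (N : Set G))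

theorem genBy_normal {G : Type} [Group G] {S : Set (Subgroup G)}
    (h : ∀ N ∈ S, N.Normal) : (genBy S).Normal := by
  constructor
  intro x hx g
  have hmap : Subgroup.map (MulAut.conj g).toMonoidHom (genBy S) ≤ genBy S := by
    rw [genBy, MonoidHom.map_closure]
    apply Subgroup.closure_mono
    rintro y ⟨z, hz, rfl⟩
    simp only [Set.mem_iUnion] at hz ⊢
    obtain ⟨N, hN, hzN⟩ := hz
    exact ⟨N, hN, (h N hN).conj_mem z hzN g⟩
  exact hmap ⟨x, hx, rfl⟩

/-- `O_𝒫(G)`: the subgroup generated by all normal `𝒫`-subgroups. -/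
def Op (P : (X : Type) → [inst : Group X] → Prop) (G : Type) [Group G] : Subgroup G :=
  genBy {N : Subgroup G | N.Normal ∧ P ↥N}

instance Op_normal (P : (X : Type) → [inst : Group X] → Prop) (G : Type) [Group G] :
    (Op P G).Normal :=
  genBy_normal fun _ hN => hN.1

/-- `N` is normal with `𝒫` quotient. -/
def QuotIsP (P : (X : Type) → [inst : Group X] → Prop) {G : Type} [Group G]
    (N : Subgroup G) : Prop :=
  ∃ h : N.Normal, haveI := h; P (G ⧸ N)

/-- `O^𝒫(G)`: the intersection of all normal subgroups with `𝒫` quotient. -/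
def Oup (P : (X : Type) → [inst : Group X] → Prop) (G : Type) [Group G] : Subgroup G :=
  ⨅ (N : Subgroup G) (_ : QuotIsP P N), N

/-- A `𝒫`-component. -/
def IsPComponent (P : (X : Type) → [inst : Group X] → Prop) {G : Type} [Group G]
    (K : Subgroup G) : Prop :=
  IsSubnormal K ∧ IsQuasisimple (↥K ⧸ Op P ↥K) ∧ Oup P ↥K = ⊤

/-- The solvable radical. -/
def solRad (G : Type) [Group G] : Subgroup G :=
  genBy {N : Subgroup G | N.Normal ∧ IsSolvable ↥N}

/-- `O_{𝒫,E}(G) = O_𝒫(G) · L_𝒫(G)`. -/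
def OPE (P : (X : Type) → [inst : Group X] → Prop) (G : Type) [Group G] : Subgroup G :=
  Op P G ⊔ sSup {K : Subgroup G | IsPComponent P K}



/-- The subgroup of points fixed by a single element `a`. -/
def fixedBySub {A : Type} (G : Type) [Monoid A] [Group G] [MulDistribMulAction A G]
    (a : A) : Subgroup G where
  carrier := {x : G | a • x = x}
  one_mem' := smul_one a
  mul_mem' := fun {x y} hx hy => by
    show a • (x * y) = x * y
    rw [smul_mul', hx, hy]
  inv_mem' := fun {x} hx => by
    show a • x⁻¹ = x⁻¹
    rw [smul_inv', hx]

/-- The subgroup of points fixed by every element of a subgroup `B` of `A`. -/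
def fixedOfSub {A : Type} (G : Type) [Group A] [Group G] [MulDistribMulAction A G]
    (B : Subgroup A) : Subgroup G where
  carrier := {x : G | ∀ b ∈ B, b • x = x}
  one_mem' := fun b _ => smul_one b
  mul_mem' := fun {x y} hx hy b hb => by rw [smul_mul', hx b hb, hy b hb]
  inv_mem' := fun {x} hx b hb => by rw [smul_inv', hx b hb]

/-- The action of `A` restricted to an `A`-invariant subgroup. -/
def invSubAction (A : Type) {G : Type} [Monoid A] [Group G] [MulDistribMulAction A G]
    (K : Subgroup G) (hK : ∀ (a : A) (x : G), x ∈ K → a • x ∈ K) :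
    MulDistribMulAction A ↥K where
  smul a x := ⟨a • (x : G), hK a x x.2⟩
  one_smul x := Subtype.ext (one_smul A (x : G))
  mul_smul a b x := Subtype.ext (mul_smul a b (x : G))
  smul_mul a x y := Subtype.ext (smul_mul' a (x : G) (y : G))
  smul_one a := Subtype.ext (smul_one a)

/-- The map induced by `a • ·` on the quotient by an `A`-invariant normal subgroup. -/
def invQuotSMul (A : Type) {G : Type} [Monoid A] [Group G] [MulDistribMulAction A G]
    (N : Subgroup G) [N.Normal] (hN : ∀ (a : A) (x : G), x ∈ N → a • x ∈ N) (a : A) :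
    G ⧸ N → G ⧸ N :=
  Quotient.map' (a • ·) (fun x y h => by
    rw [QuotientGroup.leftRel_apply] at h ⊢
    have := hN a _ h
    rwa [smul_mul', smul_inv'] at this)

theorem invQuotSMul_mk (A : Type) {G : Type} [Monoid A] [Group G] [MulDistribMulAction A G]
    (N : Subgroup G) [N.Normal] (hN : ∀ (a : A) (x : G), x ∈ N → a • x ∈ N) (a : A) (x : G) :
    invQuotSMul A N hN a (x : G ⧸ N) = ((a • x : G) : G ⧸ N) := rfl

/-- The action of `A` induced on the quotient by an `A`-invariant normal subgroup. -/
def invQuotAction (A : Type) {G : Type} [Monoid A] [Group G] [MulDistribMulAction A G]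
    (N : Subgroup G) [N.Normal] (hN : ∀ (a : A) (x : G), x ∈ N → a • x ∈ N) :
    MulDistribMulAction A (G ⧸ N) where
  smul := invQuotSMul A N hN
  one_smul q := QuotientGroup.induction_on q fun x => by
    show invQuotSMul A N hN 1 (x : G ⧸ N) = (x : G ⧸ N)
    rw [invQuotSMul_mk, one_smul]
  mul_smul a b q := QuotientGroup.induction_on q fun x => by
    show invQuotSMul A N hN (a * b) (x : G ⧸ N)
        = invQuotSMul A N hN a (invQuotSMul A N hN b (x : G ⧸ N))
    rw [invQuotSMul_mk, invQuotSMul_mk, invQuotSMul_mk, mul_smul]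
  smul_mul a q r := Quotient.inductionOn₂' q r fun x y => by
    show invQuotSMul A N hN a ((x : G ⧸ N) * (y : G ⧸ N))
        = invQuotSMul A N hN a (x : G ⧸ N) * invQuotSMul A N hN a (y : G ⧸ N)
    rw [← QuotientGroup.mk_mul, invQuotSMul_mk, invQuotSMul_mk, invQuotSMul_mk,
      ← QuotientGroup.mk_mul, smul_mul']
  smul_one a := by
    show invQuotSMul A N hN a ((1 : G) : G ⧸ N) = ((1 : G) : G ⧸ N)
    rw [invQuotSMul_mk, smul_one]

/-- The action of `A` induced on the central quotient. -/
def centerQuotAction (A : Type) (X : Type) [Group A] [Group X] [MulDistribMulAction A X] :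
    MulDistribMulAction A (X ⧸ Subgroup.center X) :=
  invQuotAction A (Subgroup.center X) (fun a x hx => by
    rw [Subgroup.mem_center_iff] at hx ⊢
    intro y
    calc y * a • x = a • (a⁻¹ • y * x) := by rw [smul_mul', smul_inv_smul]
    _ = a • (x * a⁻¹ • y) := by rw [hx (a⁻¹ • y)]
    _ = a • x * y := by rw [smul_mul', smul_inv_smul])


/-- `X` is `A`-quasisimple: it is generated by its components, the set of components
is nonempty, and `A` permutes the components transitively. -/
def IsAQuasisimple (A X : Type) [Group A] [Group X] [MulDistribMulAction A X] : Prop :=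
  {K : Subgroup X | IsComponent K}.Nonempty ∧
  sSup {K : Subgroup X | IsComponent K} = ⊤ ∧
  ∀ K L : Subgroup X, IsComponent K → IsComponent L → ∃ a : A, a • K = L

/-- An `A`-component: the subgroup generated by an orbit of `A` on the components. -/
def IsAComponent (A : Type) {G : Type} [Group A] [Group G] [MulDistribMulAction A G]
    (K : Subgroup G) : Prop :=
  ∃ L : Subgroup G, IsComponent L ∧ K = ⨆ a : A, a • L

/-- An `(A,𝒫)`-component: an `A`-invariant subnormal subgroup `K` with
`K = O^𝒫(K)` and `K/O_𝒫(K)` `A`-quasisimple under the induced action. -/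
def IsAPComponent (P : (X : Type) → [inst : Group X] → Prop) (A : Type) {G : Type}
    [Group A] [Group G] [MulDistribMulAction A G] (K : Subgroup G) : Prop :=
  IsSubnormal K ∧ Oup P ↥K = ⊤ ∧
  ∃ hK : ∀ (a : A) (x : G), x ∈ K → a • x ∈ K,
    letI := invSubAction A K hK
    ∃ hOp : ∀ (a : A) (x : ↥K), x ∈ Op P ↥K → a • x ∈ Op P ↥K,
      letI := invQuotAction A (Op P ↥K) hOp
      IsAQuasisimple A (↥K ⧸ Op P ↥K)

/-- The commutator `[X, t]` of a subgroup with an element acting on `G`;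
the subgroup generated by all `x⁻¹ * (t • x)`, `x ∈ X`. -/
def commSub {A : Type} {G : Type} [Monoid A] [Group G] [MulDistribMulAction A G]
    (t : A) (X : Subgroup G) : Subgroup G :=
  Subgroup.closure {y : G | ∃ x ∈ X, y = x⁻¹ * (t • x)}


/-- `O_{n𝒫}(G)`: the subgroup generated by all `A`-invariant normal subgroups whose
fixed-point subgroup under `A` is a `𝒫`-group. -/
def OnP (P : (X : Type) → [inst : Group X] → Prop) (A : Type) (G : Type) [Monoid A] [Group G]
    [MulDistribMulAction A G] : Subgroup G :=
  genBy {N : Subgroup G | N.Normal ∧ (∀ (a : A) (x : G), x ∈ N → a • x ∈ N) ∧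
    P ↥(N ⊓ FixedPoints.subgroup A G)}

/-- The group-theoretic property "is solvable". -/
def solP : (X : Type) → [inst : Group X] → Prop := fun X _ => IsSolvable X


section Op

variable {P : (X : Type) → [inst : Group X] → Prop}

theorem le_Op {X : Type} [Group X] {N : Subgroup X} (hN : N.Normal) (hP : P ↥N) :
    N ≤ Op P X := fun x hx =>
  Subgroup.subset_closure (Set.mem_biUnion
    (show N ∈ {N : Subgroup X | N.Normal ∧ P ↥N} from ⟨hN, hP⟩) hx)

theorem Op_le {X : Type} [Group X] {M : Subgroup X}
    (h : ∀ N : Subgroup X, N.Normal → P ↥N → N ≤ M) : Op P X ≤ M := by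
  rw [Op, genBy, Subgroup.closure_le]
  exact Set.iUnion₂_subset fun N hN => h N hN.1 hN.2

theorem Op_eq_bot_or_P
    (hJoinClosed : ∀ (X : Type) [Group X] [Finite X] (M N : Subgroup X) [M.Normal] [N.Normal],
      P ↥M → P ↥N → P ↥(M ⊔ N))
    (X : Type) [Group X] [Finite X] : Op P X = ⊥ ∨ P ↥(Op P X) := by
  by_cases hne : {N : Subgroup X | N.Normal ∧ P ↥N}.Nonempty
  · right
    obtain ⟨M, ⟨hMn, hMP⟩, hmax⟩ :=
      (Set.toFinite {N : Subgroup X | N.Normal ∧ P ↥N}).exists_maximal hne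
    have hM : Op P X = M := by
      refine le_antisymm (Op_le fun N hN hP => ?_) (le_Op hMn hMP)
      exact le_sup_right.trans
        (hmax ⟨inferInstance, hJoinClosed X M N hMP hP⟩ le_sup_left)
    rwa [hM]
  · left
    exact le_bot_iff.mp (Op_le fun N hN hP => (hne ⟨N, hN, hP⟩).elim)

theorem eq_top_of_sup_Op_eq_top
    (hIso : ∀ (X Y : Type) [Group X] [Group Y] [Finite X], Nonempty (X ≃* Y) → P X → P Y)
    (hQuotClosed : ∀ (X : Type) [Group X] [Finite X], P X → ∀ (N : Subgroup X) [N.Normal], P (X ⧸ N))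
    (hJoinClosed : ∀ (X : Type) [Group X] [Finite X] (M N : Subgroup X) [M.Normal] [N.Normal],
      P ↥M → P ↥N → P ↥(M ⊔ N))
    {X : Type} [Group X] [Finite X] (hX : Oup P X = ⊤) (M : Subgroup X) [hM : M.Normal]
    (h : M ⊔ Op P X = ⊤) : M = ⊤ := by
  rcases Op_eq_bot_or_P hJoinClosed X with hbot | hP
  · rwa [hbot, sup_bot_eq] at h
  · have hsurj : Function.Surjective ((QuotientGroup.mk' M).comp (Op P X).subtype) := by
      intro q
      obtain ⟨x, rfl⟩ := QuotientGroup.mk'_surjective M q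
      obtain ⟨r, hr, m, hm, rfl⟩ :=
        Subgroup.mem_sup_of_normal_right.mp (show x ∈ Op P X ⊔ M by rw [sup_comm, h]; trivial)
      refine ⟨⟨r, hr⟩, ?_⟩
      exact QuotientGroup.eq.mpr (by simpa using hm)
    have hq : P (X ⧸ M) := hIso _ _ ⟨QuotientGroup.quotientKerEquivOfSurjective _ hsurj⟩
      (hQuotClosed _ hP (MonoidHom.ker _))
    rw [eq_top_iff, ← hX]
    exact iInf₂_le M ⟨hM, hq⟩

theorem Op_map_mulEquiv_le
    (hIso : ∀ (X Y : Type) [Group X] [Group Y] [Finite X], Nonempty (X ≃* Y) → P X → P Y)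
    {X : Type} [Group X] [Finite X] (e : X ≃* X) : (Op P X).map e.toMonoidHom ≤ Op P X := by
  rw [Subgroup.map_le_iff_le_comap]
  refine Op_le fun N hN hP => ?_
  rw [← Subgroup.map_le_iff_le_comap]
  exact le_Op (hN.map _ e.surjective) (hIso _ _ ⟨e.subgroupMap N⟩ hP)

end Op

section Commutators

open scoped commutatorElement

/-- Every normal subgroup of a quasisimple group is central or the whole group. -/
theorem IsQuasisimple.le_center_or_eq_top {Q : Type} [Group Q] (hQ : IsQuasisimple Q)
    (M : Subgroup Q) [M.Normal] : M ≤ Subgroup.center Q ∨ M = ⊤ := by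
  obtain ⟨hperf, hsimple, -⟩ := hQ
  have hnorm : (M.map (QuotientGroup.mk' (Subgroup.center Q))).Normal :=
    Subgroup.Normal.map ‹_› _ (QuotientGroup.mk'_surjective _)
  rcases hnorm.eq_bot_or_eq_top with h | h
  · left
    rwa [Subgroup.map_eq_bot_iff, QuotientGroup.ker_mk'] at h
  · right
    have hfac : ∀ x : Q, ∃ m ∈ M, ∃ z ∈ Subgroup.center Q, x = m * z := by
      intro x
      have hx : QuotientGroup.mk' (Subgroup.center Q) x ∈
          M.map (QuotientGroup.mk' (Subgroup.center Q)) := h ▸ Subgroup.mem_top _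
      obtain ⟨m, hm, hmx⟩ := hx
      exact ⟨m, hm, m⁻¹ * x, QuotientGroup.eq.mp hmx, by group⟩
    rw [eq_top_iff, ← hperf, commutator_def, Subgroup.commutator_le]
    intro x _ y _
    obtain ⟨m, hm, z, hz, rfl⟩ := hfac x
    have hcomm : ⁅m * z, y⁆ = m * (y * m⁻¹ * y⁻¹) := by
      have h2 := Subgroup.mem_center_iff.mp hz y
      rw [commutatorElement_def, mul_inv_rev, mul_assoc m z y, ← h2]
      group
    rw [hcomm]
    exact M.mul_mem hm (Subgroup.Normal.conj_mem ‹_› _ (M.inv_mem hm) y)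

variable {G : Type} [Group G]

/-- A form of the three subgroups lemma modulo a subgroup normalized by everything in sight. -/
theorem commutator_le_of_perfect {K N D R : Subgroup G}
    (hRK : ∀ k ∈ K, ∀ r ∈ R, k * r * k⁻¹ ∈ R) (hRN : ∀ n ∈ N, ∀ r ∈ R, n * r * n⁻¹ ∈ R)
    (hperf : K ≤ ⁅K, K⁆) (hD : ∀ k ∈ K, ∀ n ∈ N, ⁅k, n⁆ ∈ D) (hDR : ⁅K, D⁆ ≤ R) : ⁅K, N⁆ ≤ R := by
  let S : Subgroup G :=
    { carrier := {k | k ∈ K ∧ ∀ n ∈ N, ⁅k, n⁆ ∈ R}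
      one_mem' := ⟨K.one_mem, fun n _ => by simp⟩
      mul_mem' := by
        rintro a b ⟨ha, ha'⟩ ⟨hb, hb'⟩
        refine ⟨K.mul_mem ha hb, fun n hn => ?_⟩
        have : ⁅a * b, n⁆ = (a * ⁅b, n⁆ * a⁻¹) * ⁅a, n⁆ := by
          simp only [commutatorElement_def]; group
        rw [this]
        exact R.mul_mem (hRK a ha _ (hb' n hn)) (ha' n hn)
      inv_mem' := by
        rintro a ⟨ha, ha'⟩
        refine ⟨K.inv_mem ha, fun n hn => ?_⟩
        have : ⁅a⁻¹, n⁆ = a⁻¹ * ⁅a, n⁆⁻¹ * a⁻¹⁻¹ := by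
          simp only [commutatorElement_def]; group
        rw [this]
        exact hRK _ (K.inv_mem ha) _ (R.inv_mem (ha' n hn)) }
  have hS : K ≤ S := by
    refine hperf.trans (Subgroup.commutator_le.mpr fun x hx y hy => ⟨?_, fun z hz => ?_⟩)
    · exact K.mul_mem (K.mul_mem (K.mul_mem hx hy) (K.inv_mem hx)) (K.inv_mem hy)
    · have hyzx : ⁅y, ⁅z⁻¹, x⁻¹⁆⁆⁻¹ ∈ R := by
        refine R.inv_mem (hDR (Subgroup.commutator_mem_commutator hy ?_))
        rw [← commutatorElement_inv]
        exact D.inv_mem (hD _ (K.inv_mem hx) _ (N.inv_mem hz))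
      have hxyz : ⁅x⁻¹, ⁅y⁻¹, z⁆⁆⁻¹ ∈ R := R.inv_mem
        (hDR (Subgroup.commutator_mem_commutator (K.inv_mem hx) (hD _ (K.inv_mem hy) _ hz)))
      have hallWitt : ⁅z, ⁅x, y⁆⁆ = x * (z * ⁅y, ⁅z⁻¹, x⁻¹⁆⁆⁻¹ * z⁻¹) * x⁻¹ *
          (x * (y * ⁅x⁻¹, ⁅y⁻¹, z⁆⁆⁻¹ * y⁻¹) * x⁻¹) := by
        simp [commutatorElement_def, mul_assoc]
      rw [← commutatorElement_inv, hallWitt]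
      exact R.inv_mem
        (R.mul_mem (hRK x hx _ (hRN z hz _ hyzx)) (hRK x hx _ (hRK y hy _ hxyz)))
  exact Subgroup.commutator_le.mpr fun k hk n hn => (hS hk).2 n hn

/-- If `⁅K, N ⊓ H⁆ ≤ R` for normal subgroups `H ≥ K` and `N` of `H'`, then `⁅K, N⁆ ≤ R`: each
`n ∈ N` satisfies `K ≤ (K ⊓ nKn⁻¹) ⊔ R`, so `N` normalizes `K`. -/
theorem commutator_le_of_commutator_inf_le {K R H H' N : Subgroup G} (hRK : R ≤ K)
    (hchar : ∀ g : G, (∀ k ∈ K, g * k * g⁻¹ ∈ K) → ∀ r ∈ R, g * r * g⁻¹ ∈ R)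
    (hperf : K ≤ ⁅K, K⁆)
    (hsup : ∀ M ≤ K, (∀ k ∈ K, ∀ m ∈ M, k * m * k⁻¹ ∈ M) → K ≤ M ⊔ R → K ≤ M)
    (hKH : K ≤ H) (hHH' : H ≤ H') (hH : ∀ g ∈ H', ∀ x ∈ H, g * x * g⁻¹ ∈ H)
    (hNH' : N ≤ H') (hN : ∀ g ∈ H', ∀ x ∈ N, g * x * g⁻¹ ∈ N)
    (h : ⁅K, N ⊓ H⁆ ≤ R) : ⁅K, N⁆ ≤ R := by
  have hD : ∀ k ∈ K, ∀ n ∈ N, ⁅k, n⁆ ∈ N ⊓ H := by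
    intro k hk n hn
    refine ⟨N.mul_mem (hN k (hHH' (hKH hk)) n hn) (N.inv_mem hn), ?_⟩
    rw [commutatorElement_def, mul_assoc, mul_assoc, ← mul_assoc n]
    exact H.mul_mem (hKH hk) (hH n (hNH' hn) _ (H.inv_mem (hKH hk)))
  have hDK : ∀ d ∈ N ⊓ H, ∀ k ∈ K, d * k * d⁻¹ ∈ K := by
    intro d hd k hk
    have h1 : ⁅k, d⁆ ∈ K := hRK (h (Subgroup.commutator_mem_commutator hk hd))
    have h2 : d * k * d⁻¹ = ⁅k, d⁆⁻¹ * k := by simp only [commutatorElement_def]; group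
    rw [h2]
    exact K.mul_mem (K.inv_mem h1) hk
  have hconjD : ∀ n ∈ N, ∀ d ∈ N ⊓ H, n * d * n⁻¹ ∈ N ⊓ H := fun n hn d hd =>
    ⟨N.mul_mem (N.mul_mem hn hd.1) (N.inv_mem hn), hH n (hNH' hn) d hd.2⟩
  have hKK : ∀ k ∈ K, ∀ l ∈ K, k * l * k⁻¹ ∈ K := fun k hk l hl =>
    K.mul_mem (K.mul_mem hk hl) (K.inv_mem hk)
  have hRconj : ∀ k ∈ K, ∀ r ∈ R, k * r * k⁻¹ ∈ R := fun k hk => hchar k (hKK k hk)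
  have hle : ∀ n ∈ N, ∀ k ∈ K, n⁻¹ * k * n ∈ K := by
    intro n hn
    let K' : Subgroup G := K.map (MulAut.conj n).toMonoidHom
    have hK' : ∀ x, x ∈ K' ↔ n⁻¹ * x * n ∈ K := by
      intro x
      constructor
      · rintro ⟨k, hk, rfl⟩
        simpa [mul_assoc] using hk
      · intro hx
        exact ⟨_, hx, by simp [mul_assoc]⟩
    have hDK' : ∀ d ∈ N ⊓ H, ∀ x ∈ K', d * x * d⁻¹ ∈ K' := by
      intro d hd x hx
      rw [hK'] at hx ⊢
      have hd' := hconjD n⁻¹ (N.inv_mem hn) d hd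
      have := hDK _ hd' _ hx
      convert this using 1
      group
    have hKK' : ∀ k ∈ K, ∀ x ∈ K', k * x * k⁻¹ ∈ K' := by
      intro k hk x hx
      have h1 : n * k * n⁻¹ ∈ K' := (hK' _).mpr (by simpa [mul_assoc] using hk)
      have h2 := hDK' _ (hD k hk n hn) x hx
      have h3 := K'.mul_mem (K'.mul_mem h1 hx) (K'.inv_mem h1)
      have h4 := hDK' _ (hD k hk n hn) _ h3
      convert h4 using 1
      simp only [commutatorElement_def]; group
    have hK'K : ∀ k ∈ K, ∀ l ∈ K, (n * k * n⁻¹) * l * (n * k * n⁻¹)⁻¹ ∈ K := by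
      intro k hk l hl
      have h1 := hDK _ ((N ⊓ H).inv_mem (hD k hk n hn)) _ (hKK k hk l hl)
      convert h1 using 1
      simp only [commutatorElement_def]; group
    have hmain : K ≤ K ⊓ K' := by
      refine hsup _ inf_le_left (fun k hk m hm => ⟨hKK k hk m hm.1, hKK' k hk m hm.2⟩) ?_
      refine hperf.trans (Subgroup.commutator_le.mpr fun k hk l hl => ?_)
      set c := n * k * n⁻¹ with hc
      have hcK' : c ∈ K' := (hK' _).mpr (by simpa [hc, mul_assoc] using hk)
      have hd : c⁻¹ * k ∈ N ⊓ H := by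
        have h1 := hD k⁻¹ (K.inv_mem hk) n hn
        have h2 := (N ⊓ H).inv_mem h1
        convert h2 using 1
        simp only [hc, commutatorElement_def]; group
      have hdl : ⁅c⁻¹ * k, l⁆ ∈ R := by
        rw [← commutatorElement_inv]
        exact R.inv_mem (h (Subgroup.commutator_mem_commutator hl hd))
      have hr : c * ⁅c⁻¹ * k, l⁆ * c⁻¹ ∈ R := hchar c (hK'K k hk) _ hdl
      have heq : ⁅k, l⁆ = (c * ⁅c⁻¹ * k, l⁆ * c⁻¹) * ⁅c, l⁆ := by
        simp only [commutatorElement_def]; group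
      have hcl : ⁅c, l⁆ ∈ K ⊓ K' := by
        refine ⟨K.mul_mem (hK'K k hk l hl) (K.inv_mem hl), ?_⟩
        have h1 := K'.mul_mem hcK' (hKK' l hl _ (K'.inv_mem hcK'))
        rwa [← mul_assoc, ← mul_assoc] at h1
      rw [heq]
      exact Subgroup.mul_mem _ (Subgroup.mem_sup_right hr) (Subgroup.mem_sup_left hcl)
    exact fun k hk => (hK' k).mp (hmain hk).2
  have hNK : ∀ n ∈ N, ∀ k ∈ K, n * k * n⁻¹ ∈ K := fun n hn k hk => by
    simpa using hle n⁻¹ (N.inv_mem hn) k hk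
  exact commutator_le_of_perfect hRconj (fun n hn => hchar n (hNK n hn)) hperf hD h

theorem conj_mem_of_normal_subgroupOf {A B : Subgroup G} (h : A ≤ B)
    (hn : (A.subgroupOf B).Normal) : ∀ b ∈ B, ∀ a ∈ A, b * a * b⁻¹ ∈ A :=
  fun b hb a ha => hn.conj_mem ⟨a, h ha⟩ ha ⟨b, hb⟩

theorem le_or_commutator_le_of_normal {K R L N : Subgroup G} (hRK : R ≤ K)
    (hchar : ∀ g : G, (∀ k ∈ K, g * k * g⁻¹ ∈ K) → ∀ r ∈ R, g * r * g⁻¹ ∈ R)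
    (hperf : K ≤ ⁅K, K⁆)
    (hsup : ∀ M ≤ K, (∀ k ∈ K, ∀ m ∈ M, k * m * k⁻¹ ∈ M) → K ≤ M ⊔ R → K ≤ M)
    (hdich : ∀ M ≤ K, (∀ k ∈ K, ∀ m ∈ M, k * m * k⁻¹ ∈ M) → K ≤ M ∨ ⁅K, M⁆ ≤ R)
    (hK : IsSubnormal K) (hKL : K ≤ L) (hNL : N ≤ L)
    (hN : ∀ g ∈ L, ∀ x ∈ N, g * x * g⁻¹ ∈ N) : K ≤ N ∨ ⁅K, N⁆ ≤ R := by
  obtain ⟨n, c, h0, hlast, hc⟩ := hK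
  have hKc : ∀ i, K ≤ c i := fun i =>
    Fin.induction h0.ge (fun i hi => hi.trans (hc i).1) i
  have key : ∀ i, ∀ N : Subgroup G, N ≤ c i ⊓ L →
      (∀ g ∈ c i ⊓ L, ∀ x ∈ N, g * x * g⁻¹ ∈ N) → K ≤ N ∨ ⁅K, N⁆ ≤ R := by
    intro i
    induction i using Fin.induction with
    | zero =>
      rw [h0, inf_eq_left.mpr hKL]
      exact hdich
    | succ i ih =>
      intro N hN hconj
      have hcN := conj_mem_of_normal_subgroupOf (hc i).1 (hc i).2
      have hmono : c i.castSucc ⊓ L ≤ c i.succ ⊓ L := inf_le_inf_right _ (hc i).1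
      have hHconj : ∀ g ∈ c i.succ ⊓ L, ∀ x ∈ c i.castSucc ⊓ L,
          g * x * g⁻¹ ∈ c i.castSucc ⊓ L := fun g hg x hx =>
        ⟨hcN g hg.1 x hx.1, L.mul_mem (L.mul_mem hg.2 hx.2) (L.inv_mem hg.2)⟩
      rcases ih (N ⊓ (c i.castSucc ⊓ L)) inf_le_right (fun g hg x hx =>
        ⟨hconj g (hmono hg) x hx.1, hHconj g (hmono hg) x hx.2⟩) with h | h
      · exact Or.inl (h.trans inf_le_left)
      · exact Or.inr (commutator_le_of_commutator_inf_le hRK hchar hperf hsup (le_inf (hKc _) hKL) hmono hHconj hN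
          hconj h)
  have := key (Fin.last n) N
  rw [hlast, top_inf_eq] at this
  exact this hNL hN

theorem le_or_commutator_le_of_isSubnormal {K R N : Subgroup G} (hRK : R ≤ K)
    (hchar : ∀ g : G, (∀ k ∈ K, g * k * g⁻¹ ∈ K) → ∀ r ∈ R, g * r * g⁻¹ ∈ R)
    (hperf : K ≤ ⁅K, K⁆)
    (hsup : ∀ M ≤ K, (∀ k ∈ K, ∀ m ∈ M, k * m * k⁻¹ ∈ M) → K ≤ M ⊔ R → K ≤ M)
    (hdich : ∀ M ≤ K, (∀ k ∈ K, ∀ m ∈ M, k * m * k⁻¹ ∈ M) → K ≤ M ∨ ⁅K, M⁆ ≤ R)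
    (hK : IsSubnormal K) (hN : IsSubnormal N) : K ≤ N ∨ ⁅K, N⁆ ≤ R := by
  obtain ⟨n, c, h0, hlast, hc⟩ := hN
  have key : ∀ i, K ≤ c i ∨ ⁅K, c i⁆ ≤ R := by
    intro i
    induction i using Fin.reverseInduction with
    | last => exact Or.inl (hlast ▸ le_top)
    | cast i ih =>
      rcases ih with h | h
      · exact le_or_commutator_le_of_normal hRK hchar hperf hsup hdich hK h (hc i).1
          (conj_mem_of_normal_subgroupOf (hc i).1 (hc i).2)
      · exact Or.inr ((Subgroup.commutator_mono le_rfl (hc i).1).trans h)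
  exact h0 ▸ key 0

end Commutators

theorem statement_4
    (P : (X : Type) → [inst : Group X] → Prop)
    (hIso : ∀ (X Y : Type) [Group X] [Group Y] [Finite X], Nonempty (X ≃* Y) → P X → P Y)
    (hSubClosed : ∀ (X : Type) [Group X] [Finite X], P X → ∀ H : Subgroup X, P ↥H)
    (hQuotClosed : ∀ (X : Type) [Group X] [Finite X], P X → ∀ (N : Subgroup X) [N.Normal], P (X ⧸ N))
    (hInfClosed : ∀ (X : Type) [Group X] [Finite X] (M N : Subgroup X) [M.Normal] [N.Normal],
      P (X ⧸ M) → P (X ⧸ N) → P (X ⧸ (M ⊓ N)))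
    (hJoinClosed : ∀ (X : Type) [Group X] [Finite X] (M N : Subgroup X) [M.Normal] [N.Normal],
      P ↥M → P ↥N → P ↥(M ⊔ N))
    (G : Type) [Group G] [Finite G] (K N : Subgroup G)
    (hK : IsPComponent P K) (hN : IsSubnormal N) :
    K ≤ N ∨ ⁅K, N⁆ ≤ (Op P ↥K).map K.subtype := by
  obtain ⟨hKs, hKq, hKO⟩ := hK
  have htop := fun (M : Subgroup ↥K) [M.Normal] =>
    eq_top_of_sup_Op_eq_top hIso hQuotClosed hJoinClosed hKO M
  have hnormal : ∀ M ≤ K, (∀ k ∈ K, ∀ m ∈ M, k * m * k⁻¹ ∈ M) → (M.subgroupOf K).Normal :=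
    fun M _ h => ⟨fun m hm k => h k k.2 m hm⟩
  have hsup_of_map : ∀ M : Subgroup ↥K, M.map (QuotientGroup.mk' (Op P ↥K)) = ⊤ →
      M ⊔ Op P ↥K = ⊤ := by
    intro M hM
    have := congrArg (Subgroup.comap (QuotientGroup.mk' (Op P ↥K))) hM
    rwa [Subgroup.comap_map_eq, QuotientGroup.ker_mk', Subgroup.comap_top] at this
  refine le_or_commutator_le_of_isSubnormal (Subgroup.map_subtype_le _) ?_ ?_ ?_ ?_ hKs hN
  · rintro g hg _ ⟨r, hr, rfl⟩
    have hmap : K.map (MulAut.conj g).toMonoidHom = K :=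
      Subgroup.eq_of_le_of_card_ge (by rintro _ ⟨k, hk, rfl⟩; exact hg k hk)
        (Nat.card_congr ((MulAut.conj g).subgroupMap K).toEquiv).le
    let e : ↥K ≃* ↥K := ((MulAut.conj g).subgroupMap K).trans (MulEquiv.subgroupCongr hmap)
    exact ⟨e r, Op_map_mulEquiv_le hIso e ⟨r, hr, rfl⟩, rfl⟩
  · have hcomm : commutator ↥K = ⊤ := by
      refine htop _ (hsup_of_map _ ?_)
      rw [commutator_def, Subgroup.map_commutator,
        Subgroup.map_top_of_surjective _ (QuotientGroup.mk'_surjective _)]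
      exact hKq.1
    have := congrArg (Subgroup.map K.subtype) hcomm
    rw [commutator_def, Subgroup.map_commutator, ← MonoidHom.range_eq_map,
      Subgroup.range_subtype] at this
    exact this.ge
  · intro M hM hconj h
    have := hnormal M hM hconj
    rw [← Subgroup.subgroupOf_eq_top]
    refine htop _ (Subgroup.map_injective K.subtype_injective ?_)
    rw [Subgroup.map_sup, Subgroup.subgroupOf_map_subtype, inf_eq_left.mpr hM,
      ← MonoidHom.range_eq_map, Subgroup.range_subtype]
    exact le_antisymm (sup_le hM (Subgroup.map_subtype_le _)) h
  · intro M hM hconj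
    have := hnormal M hM hconj
    have : ((M.subgroupOf K).map (QuotientGroup.mk' (Op P ↥K))).Normal :=
      Subgroup.Normal.map inferInstance _ (QuotientGroup.mk'_surjective _)
    rcases hKq.le_center_or_eq_top ((M.subgroupOf K).map (QuotientGroup.mk' (Op P ↥K)))
      with h | h
    · right
      refine Subgroup.commutator_le.mpr fun k hk m hm => ?_
      refine ⟨⟨k, hk⟩ * ⟨m, hM hm⟩ * ⟨k, hk⟩⁻¹ * ⟨m, hM hm⟩⁻¹, ?_, rfl⟩
      have hz := Subgroup.mem_center_iff.mp
        (h (Subgroup.mem_map_of_mem _ (show ⟨m, hM hm⟩ ∈ M.subgroupOf K from hm)))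
        (QuotientGroup.mk' (Op P ↥K) ⟨k, hk⟩)
      rw [← QuotientGroup.ker_mk' (Op P ↥K), SetLike.mem_coe]
      rw [MonoidHom.mem_ker, map_mul, map_mul, map_mul, hz, map_inv, map_inv]
      group
    · left
      rw [← Subgroup.subgroupOf_eq_top]
      exact htop _ (hsup_of_map _ h)

end PaperPF
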